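/- arXiv:1607.04233 — 2 statements merged into one kernel-verified Lean document; each statement's English description precedes it below -/
import Mathlib

section
/- Let E be a finite set and let S be a set of vectors in ℤ^E. Then the dimension of the ℝ-linear span of S inside ℝ^E is greater than or equal to the dimension of the GF(2)-linear span, inside GF(2)^E, of the set f(S) of coordinatewise mod-2 reductions of the elements of S. -/
/-- Integer vectors whose reductions modulo a prime `p` are linearly independent over `ZMod p`
are linearly independent over `ℤ`. -/
theorem LinearIndependent.of_intCast_zmod {ι E : Type*} (p : ℕ) [hp : Fact p.Prime]
    {v : ι → E → ℤ} (hv : LinearIndependent (ZMod p) fun i e => (v i e : ZMod p)) :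
    LinearIndependent ℤ v := by
  rw [linearIndependent_iff'] at hv ⊢
  intro s c hc
  have descent : ∀ (n : ℕ) (c : ι → ℤ), ∑ i ∈ s, c i • v i = 0 →
      ∀ i ∈ s, (p : ℤ) ^ n ∣ c i := by
    intro n
    induction n with
    | zero => simp
    | succ n ih =>
      intro c hc
      have hdvd : ∀ i ∈ s, (p : ℤ) ∣ c i := by
        intro i hi
        rw [← ZMod.intCast_zmod_eq_zero_iff_dvd]
        refine hv s (fun i => (c i : ZMod p)) ?_ i hi
        ext e
        have := congrArg (Int.cast : ℤ → ZMod p) (congrFun hc e)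
        simpa using this
      have hquot : ∑ i ∈ s, (c i / p) • v i = 0 := by
        refine (smul_eq_zero_iff_right (Nat.cast_ne_zero.2 hp.out.ne_zero : (p : ℤ) ≠ 0)).1 ?_
        rw [Finset.smul_sum, ← hc]
        refine Finset.sum_congr rfl fun i hi => ?_
        rw [smul_smul, Int.mul_ediv_cancel' (hdvd i hi)]
      intro i hi
      rw [pow_succ', ← Int.mul_ediv_cancel' (hdvd i hi)]
      exact mul_dvd_mul_left _ (ih _ hquot i hi)
  intro i hi
  by_contra hne
  have hfin : FiniteMultiplicity (p : ℤ) (c i) :=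
    Int.finiteMultiplicity_iff.2 ⟨by simpa using hp.out.ne_one, hne⟩
  obtain ⟨n, hn⟩ := hfin
  exact hn (descent _ c hc i hi)

/-- For a finite set `E` and a set `S` of vectors in `ℤ^E`, the dimension of the
ℝ-linear span of `S` inside `ℝ^E` is at least the dimension of the GF(2)-linear span of the
coordinatewise mod-2 reductions of the elements of `S` inside `GF(2)^E`. -/
theorem real_span_dim_ge_mod_two_span_dim {E : Type*} [Fintype E] (S : Set (E → ℤ)) :
    Module.finrank (ZMod 2)
        (Submodule.span (ZMod 2) ((fun v : E → ℤ => fun e => ((v e : ZMod 2))) '' S)) ≤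
      Module.finrank ℝ
        (Submodule.span ℝ ((fun v : E → ℤ => fun e => ((v e : ℝ))) '' S)) := by
  obtain ⟨w, hwS, -, hw⟩ := Submodule.exists_fun_fin_finrank_span_eq (ZMod 2)
    ((fun v : E → ℤ => fun e => ((v e : ZMod 2))) '' S)
  choose v hvS hvw using hwS
  obtain rfl : (fun i e => (v i e : ZMod 2)) = w := funext hvw
  have hvZ : LinearIndependent ℤ v := LinearIndependent.of_intCast_zmod 2 hw
  have hvR : LinearIndependent ℝ fun i => algebraMap ℤ ℝ ∘ v i :=
    linearIndependent_algebraMap_comp_iff.2 hvZ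
  have hcard := (finrank_span_eq_card hvR).symm
  rw [Fintype.card_fin] at hcard
  rw [hcard]
  refine Submodule.finrank_mono (Submodule.span_mono ?_)
  rintro _ ⟨i, rfl⟩
  exact ⟨v i, hvS i, rfl⟩
end

section
/- Let E be a finite set, let W be an ℝ-linear subspace of ℝ^E, and let S be a finite set of vectors in ℤ^E each of which lies in W. If the dimension over GF(2) of the span of the coordinatewise mod-2 reductions of the elements of S in GF(2)^E is at least the dimension of W over ℝ, then S spans W over ℝ. -/
/-- Integer vectors whose reductions modulo a prime are linearly independent are linearly
independent over every field of characteristic zero. -/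
theorem linearIndependent_intCast_of_zmod {ι E K : Type*} [Finite ι] [Finite E] [Field K]
    [CharZero K] (p : ℕ) [Fact p.Prime] (A : Matrix ι E ℤ)
    (hA : LinearIndependent (ZMod p) (A.map (Int.cast : ℤ → ZMod p)).row) :
    LinearIndependent K (A.map (Int.cast : ℤ → K)).row := by
  classical
  obtain ⟨_⟩ := nonempty_fintype ι
  obtain ⟨_⟩ := nonempty_fintype E
  obtain ⟨B, hB⟩ : ∃ B : Matrix E ι (ZMod p), A.map (Int.cast : ℤ → ZMod p) * B = 1 := by
    rw [← Matrix.vecMul_injective_iff] at hA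
    obtain ⟨g, hg⟩ := LinearMap.exists_leftInverse_of_injective
      (Matrix.vecMulLinear (A.map (Int.cast : ℤ → ZMod p))) (LinearMap.ker_eq_bot.mpr hA)
    refine ⟨LinearMap.toMatrixRight' g, Matrix.toLinearMapRight'.injective ?_⟩
    rw [Matrix.toLinearMapRight'_mul, Matrix.toLinearMapRight'_one,
      LinearEquiv.symm_apply_apply]
    exact hg
  choose C hC using fun e i => ZMod.intCast_surjective (B e i)
  have hdet : (A * Matrix.of C).det ≠ 0 := by
    intro h
    have hmap : (A * Matrix.of C).map (Int.castRingHom (ZMod p)) = 1 := by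
      rw [Matrix.map_mul, ← hB]
      congr 1
      ext e i
      exact hC e i
    have := congrArg (Int.castRingHom (ZMod p)) h
    rw [RingHom.map_det, RingHom.mapMatrix_apply, hmap] at this
    simp at this
  have hdetK : ((A * Matrix.of C).map (Int.castRingHom K)).det ≠ 0 := by
    rw [← RingHom.mapMatrix_apply, ← RingHom.map_det]
    simpa using hdet
  rw [← Matrix.vecMul_injective_iff]
  have hinj := Matrix.vecMul_injective_of_isUnit
    ((Matrix.isUnit_iff_isUnit_det _).mpr hdetK.isUnit)
  rw [Matrix.map_mul] at hinj
  intro x y hxy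
  apply hinj
  simp only [← Matrix.vecMul_vecMul]
  exact congrArg (fun z => Matrix.vecMul z _) hxy


/-- Let `W` be an ℝ-linear subspace of `ℝ^E` and `S` a finite set of integer
vectors all lying in `W`. If the GF(2)-dimension of the span of the mod-2 reductions of the
elements of `S` is at least the ℝ-dimension of `W`, then `S` spans `W` over ℝ. -/
theorem span_eq_of_mod_two_dim_ge {E : Type*} [Fintype E] (W : Submodule ℝ (E → ℝ))
    (S : Finset (E → ℤ))
    (hSW : ∀ v ∈ S, (fun e => ((v e : ℝ))) ∈ W)
    (hdim : Module.finrank ℝ W ≤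
      Module.finrank (ZMod 2)
        (Submodule.span (ZMod 2) ((fun v : E → ℤ => fun e => ((v e : ZMod 2))) '' ↑S))) :
    Submodule.span ℝ ((fun v : E → ℤ => fun e => ((v e : ℝ))) '' ↑S) = W := by
  classical
  refine Submodule.eq_of_le_of_finrank_le (Submodule.span_le.mpr ?_) (hdim.trans ?_)
  · rintro _ ⟨v, hv, rfl⟩
    exact hSW v hv
  · obtain ⟨b, hbS, hspan, hli⟩ := exists_linearIndependent (ZMod 2)
      ((fun v : E → ℤ => fun e => ((v e : ZMod 2))) '' ↑S)
    have : Fintype b := ((S.finite_toSet.image _).subset hbS).fintype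
    choose lift hliftS hlift using fun x : b => hbS x.2
    have hliR : LinearIndependent ℝ (fun x : b => fun e => (lift x e : ℝ)) := by
      refine linearIndependent_intCast_of_zmod 2 (Matrix.of lift) ?_
      have hrow : ((Matrix.of lift).map (Int.cast : ℤ → ZMod 2)).row = Subtype.val :=
        funext hlift
      rwa [hrow]
    rw [← hspan, finrank_span_set_eq_card hli, Set.toFinset_card,
      ← finrank_span_eq_card hliR]
    refine Submodule.finrank_mono (Submodule.span_mono ?_)
    rintro _ ⟨x, rfl⟩
    exact ⟨lift x, hliftS x, rfl⟩
end
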